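/- arXiv:1601.06129 — 4 statements merged into one kernel-verified Lean document; each statement's English description precedes it below -/
import Mathlib

section
/- Let p, J, M, L_r, τ_r be positive reals and let ω, ψ_α, ψ_β : ℝ → ℝ be functions differentiable at a point t with ψ_α(t)² + ψ_β(t)² ≠ 0. Define Δ_IM(t) := (p/J)(M²/L_r²)·[(1/τ_r)·ω'(t)·(ψ_α(t)² + ψ_β(t)²) − (ω(t)² + 1/τ_r²)·(ψ_α'(t)ψ_β(t) − ψ_β'(t)ψ_α(t))]. Then Δ_IM(t) ≠ 0 if and only if τ_r·ω'(t)/(1 + τ_r²·ω(t)²) ≠ (ψ_α'(t)ψ_β(t) − ψ_β'(t)ψ_α(t))/(ψ_α(t)² + ψ_β(t)²); moreover the left-hand side equals the derivative at t of the function s ↦ arctan(τ_r·ω(s)). -/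
/-- Geometric interpretation of the induction-machine observability determinant:
`Δ_IM(t) ≠ 0` iff `d/dt arctan(τ_r ω) ≠ (ψ_α' ψ_β − ψ_β' ψ_α)/(ψ_α² + ψ_β²)`,
and the left-hand side is the derivative of `s ↦ arctan(τ_r ω(s))`. -/
theorem im_determinant_geometric
    (p J M Lr τr : ℝ) (hp : 0 < p) (hJ : 0 < J) (hM : 0 < M) (hLr : 0 < Lr)
    (hτr : 0 < τr)
    (ω ψα ψβ : ℝ → ℝ) (t : ℝ)
    (hω : DifferentiableAt ℝ ω t) (hψα : DifferentiableAt ℝ ψα t)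
    (hψβ : DifferentiableAt ℝ ψβ t)
    (hψ : ψα t ^ 2 + ψβ t ^ 2 ≠ 0) :
    ((p / J) * (M ^ 2 / Lr ^ 2) *
        ((1 / τr) * deriv ω t * (ψα t ^ 2 + ψβ t ^ 2) -
          (ω t ^ 2 + 1 / τr ^ 2) * (deriv ψα t * ψβ t - deriv ψβ t * ψα t)) ≠ 0 ↔
      τr * deriv ω t / (1 + τr ^ 2 * ω t ^ 2) ≠
        (deriv ψα t * ψβ t - deriv ψβ t * ψα t) / (ψα t ^ 2 + ψβ t ^ 2)) ∧
    deriv (fun s => Real.arctan (τr * ω s)) t =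
      τr * deriv ω t / (1 + τr ^ 2 * ω t ^ 2) := by
  have hpos : 0 < 1 + τr ^ 2 * ω t ^ 2 := by positivity
  have hc : (p / J) * (M ^ 2 / Lr ^ 2) ≠ 0 := by positivity
  refine ⟨not_congr ?_, ?_⟩
  · have hbracket : (1 / τr) * deriv ω t * (ψα t ^ 2 + ψβ t ^ 2) -
          (ω t ^ 2 + 1 / τr ^ 2) * (deriv ψα t * ψβ t - deriv ψβ t * ψα t) =
        (τr * deriv ω t * (ψα t ^ 2 + ψβ t ^ 2) -
          (deriv ψα t * ψβ t - deriv ψβ t * ψα t) * (1 + τr ^ 2 * ω t ^ 2)) / τr ^ 2 := by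
      field_simp
      ring
    rw [mul_eq_zero_iff_left hc, hbracket, div_eq_zero_iff, or_iff_left (by positivity),
      sub_eq_zero, div_eq_div_iff hpos.ne' hψ]
  · rw [((hω.hasDerivAt.const_mul τr).arctan).deriv, mul_pow, one_div_mul_eq_div]
end

section
/- Let R_s, R_f, L₀, L₂, M_f, L_f be reals with L_f ≠ 0, L_d := L₀ + L₂, L_q := L₀ − L₂, L_δ := L_d − L_q, L_D := L_d − M_f²/L_f, L_Δ := L_δ − M_f²/L_f, and assume L_D ≠ 0 and L_q ≠ 0. For θ ∈ ℝ let 𝔏(θ) be the 3×3 matrix ![![L₀+L₂cos2θ, L₂sin2θ, M_f cosθ],![L₂sin2θ, L₀−L₂cos2θ, M_f sinθ],![M_f cosθ, M_f sinθ, L_f]], let 𝔏'(θ) and 𝔏''(θ) be its entrywise first and second derivatives in θ, let ℜ := diag(R_s,R_s,R_f), and for ω ∈ ℝ let ℜ_eq := ℜ + ω𝔏'(θ). Assume 𝔏(θ) is invertible. Given I = (i_α,i_β,i_f) ∈ ℝ³ and V ∈ ℝ³, set İ := 𝔏(θ)⁻¹(V − ℜ_eq I). Let O₅ be the 5×5 matrix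 whose rows 1–3 are the rows of [I₃ | 0] (the 3×3 identity padded with two zero columns) and whose rows 4–5 are the first two rows of the 3×5 block matrix [−𝔏⁻¹ℜ_eq | −𝔏⁻¹𝔏'I | −𝔏⁻¹𝔏'𝔏⁻¹·𝔏İ − ω𝔏⁻¹𝔏''I]. Define the Park variables i_d := i_α cosθ + i_β sinθ, i_q := −i_α sinθ + i_β cosθ, and their trajectory derivatives i̇_d := İ_1 cosθ + İ_2 sinθ + ω·i_q, i̇_q := −İ_1 sinθ + İ_2 cosθ − ω·i_d, i̇_f := İ_3. Then det O₅ = (1/(L_D L_q))·[(L_δ i_d + M_f i_f)² + L_Δ L_δ i_q²]·ω + (L_Δ/(L_D L_q))·[(L_δ i̇_d + M_f i̇_f)·i_q − (L_δ i_d + M_f i_f)·i̇_q]. -/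
open Matrix

/-- Inductance matrix of the wound-rotor synchronous machine. -/
noncomputable def Lmat (L₀ L₂ Mf Lf : ℝ) (θ : ℝ) : Matrix (Fin 3) (Fin 3) ℝ :=
  !![L₀ + L₂ * Real.cos (2 * θ), L₂ * Real.sin (2 * θ), Mf * Real.cos θ;
     L₂ * Real.sin (2 * θ), L₀ - L₂ * Real.cos (2 * θ), Mf * Real.sin θ;
     Mf * Real.cos θ, Mf * Real.sin θ, Lf]

/-- Entrywise derivative of the inductance matrix with respect to the position `θ`. -/
noncomputable def Lmat' (L₀ L₂ Mf Lf : ℝ) (θ : ℝ) : Matrix (Fin 3) (Fin 3) ℝ :=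
  Matrix.of fun i j => deriv (fun θ' => Lmat L₀ L₂ Mf Lf θ' i j) θ

/-- Entrywise second derivative of the inductance matrix with respect to `θ`. -/
noncomputable def Lmat'' (L₀ L₂ Mf Lf : ℝ) (θ : ℝ) : Matrix (Fin 3) (Fin 3) ℝ :=
  Matrix.of fun i j => deriv (deriv (fun θ' => Lmat L₀ L₂ Mf Lf θ' i j)) θ

theorem Lmat'_eq (L₀ L₂ Mf Lf θ : ℝ) :
    Lmat' L₀ L₂ Mf Lf θ =
      !![-(2 * L₂ * Real.sin (2 * θ)), 2 * L₂ * Real.cos (2 * θ), -(Mf * Real.sin θ);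
         2 * L₂ * Real.cos (2 * θ), 2 * L₂ * Real.sin (2 * θ), Mf * Real.cos θ;
         -(Mf * Real.sin θ), Mf * Real.cos θ, 0] := by
  have h2 (x : ℝ) : HasDerivAt (fun y : ℝ => 2 * y) 2 x := by
    simpa using (hasDerivAt_id x).const_mul 2
  have hc := ((h2 θ).cos.const_mul L₂)
  have hs := ((h2 θ).sin.const_mul L₂)
  have hc1 := (Real.hasDerivAt_cos θ).const_mul Mf
  have hs1 := (Real.hasDerivAt_sin θ).const_mul Mf
  ext i j
  fin_cases i <;> fin_cases j <;> simp [Lmat', Lmat, hc.deriv, hs.deriv] <;> ring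

theorem Lmat''_eq (L₀ L₂ Mf Lf θ : ℝ) :
    Lmat'' L₀ L₂ Mf Lf θ =
      !![-(4 * L₂ * Real.cos (2 * θ)), -(4 * L₂ * Real.sin (2 * θ)), -(Mf * Real.cos θ);
         -(4 * L₂ * Real.sin (2 * θ)), 4 * L₂ * Real.cos (2 * θ), -(Mf * Real.sin θ);
         -(Mf * Real.cos θ), -(Mf * Real.sin θ), 0] := by
  have h2 (x : ℝ) : HasDerivAt (fun y : ℝ => 2 * y) 2 x := by
    simpa using (hasDerivAt_id x).const_mul 2
  have hc := (h2 θ).cos.const_mul (2 * L₂)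
  have hs := (h2 θ).sin.const_mul (2 * L₂)
  have key (i j : Fin 3) : deriv (fun θ' => Lmat L₀ L₂ Mf Lf θ' i j) =
      fun θ' => Lmat' L₀ L₂ Mf Lf θ' i j := rfl
  ext i j
  simp only [Lmat'', of_apply, key, Lmat'_eq]
  fin_cases i <;> fin_cases j <;>
    simp [hc.deriv, hs.deriv] <;> ring

/-- The first two entries of `p` and `q` span an area that, in the rotor frame, is read off from
`L p` and `L q` after eliminating the field winding. -/
theorem Lmat_mulVec_cross (L₀ L₂ Mf Lf θ : ℝ) (hLf : Lf ≠ 0) (p q u w : Fin 3 → ℝ)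
    (hu : Lmat L₀ L₂ Mf Lf θ *ᵥ p = u) (hw : Lmat L₀ L₂ Mf Lf θ *ᵥ q = w) :
    (L₀ + L₂ - Mf ^ 2 / Lf) * (L₀ - L₂) * (p 0 * q 1 - p 1 * q 0) =
      (u 0 * Real.cos θ + u 1 * Real.sin θ - Mf / Lf * u 2) *
          (-(w 0) * Real.sin θ + w 1 * Real.cos θ) -
        (w 0 * Real.cos θ + w 1 * Real.sin θ - Mf / Lf * w 2) *
          (-(u 0) * Real.sin θ + u 1 * Real.cos θ) := by
  have hcs := Real.sin_sq_add_cos_sq θ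
  have direct (r : Fin 3 → ℝ) :
      (Lmat L₀ L₂ Mf Lf θ *ᵥ r) 0 * Real.cos θ + (Lmat L₀ L₂ Mf Lf θ *ᵥ r) 1 * Real.sin θ -
          Mf / Lf * (Lmat L₀ L₂ Mf Lf θ *ᵥ r) 2 =
        (L₀ + L₂ - Mf ^ 2 / Lf) * (r 0 * Real.cos θ + r 1 * Real.sin θ) := by
    simp only [Lmat, mulVec, dotProduct, Fin.sum_univ_three, of_apply, cons_val,
      Real.cos_two_mul', Real.sin_two_mul]
    field_simp
    grind
  have quadrature (r : Fin 3 → ℝ) :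
      -((Lmat L₀ L₂ Mf Lf θ *ᵥ r) 0) * Real.sin θ + (Lmat L₀ L₂ Mf Lf θ *ᵥ r) 1 * Real.cos θ =
        (L₀ - L₂) * (-(r 0) * Real.sin θ + r 1 * Real.cos θ) := by
    simp only [Lmat, mulVec, dotProduct, Fin.sum_univ_three, of_apply, cons_val,
      Real.cos_two_mul', Real.sin_two_mul]
    grind
  rw [← hu, ← hw, direct, direct, quadrature, quadrature]
  linear_combination
    -(L₀ + L₂ - Mf ^ 2 / Lf) * (L₀ - L₂) * (p 0 * q 1 - p 1 * q 0) * hcs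

theorem det_identity_rows (a b c x y d e f z w : ℝ) :
    det !![1, 0, 0, 0, 0; 0, 1, 0, 0, 0; 0, 0, 1, 0, 0; a, b, c, x, z; d, e, f, y, w] =
      x * w - y * z := by
  simp [det_succ_row_zero, Fin.sum_univ_succ, Fin.succAbove]
  ring

/-- Determinant of the partial observability matrix of the WRSM, expressed in the
rotor (dq) reference frame. -/
theorem wrsm_observability_determinant
    (Rs Rf L₀ L₂ Mf Lf : ℝ) (hLf : Lf ≠ 0)
    (Ld Lq Lδ LD LΔ : ℝ)
    (hLd : Ld = L₀ + L₂) (hLq : Lq = L₀ - L₂) (hLδ : Lδ = Ld - Lq)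
    (hLD : LD = Ld - Mf ^ 2 / Lf) (hLΔ : LΔ = Lδ - Mf ^ 2 / Lf)
    (hLDne : LD ≠ 0) (hLqne : Lq ≠ 0)
    (θ ω : ℝ) (hinv : IsUnit (Lmat L₀ L₂ Mf Lf θ))
    (I V : Fin 3 → ℝ) :
    (let L := Lmat L₀ L₂ Mf Lf θ
     let L' := Lmat' L₀ L₂ Mf Lf θ
     let L'' := Lmat'' L₀ L₂ Mf Lf θ
     let R : Matrix (Fin 3) (Fin 3) ℝ := !![Rs, 0, 0; 0, Rs, 0; 0, 0, Rf]
     let Req := R + ω • L'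
     let Idot := L⁻¹.mulVec (V - Req.mulVec I)
     let M1 := -(L⁻¹ * Req)
     let v1 := -((L⁻¹ * L').mulVec I)
     let v2 := -((L⁻¹ * L' * L⁻¹).mulVec (L.mulVec Idot)) - ω • ((L⁻¹ * L'').mulVec I)
     let O₅ : Matrix (Fin 5) (Fin 5) ℝ :=
       !![1, 0, 0, 0, 0;
          0, 1, 0, 0, 0;
          0, 0, 1, 0, 0;
          M1 0 0, M1 0 1, M1 0 2, v1 0, v2 0;
          M1 1 0, M1 1 1, M1 1 2, v1 1, v2 1]
     let id := I 0 * Real.cos θ + I 1 * Real.sin θ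
     let iq := -(I 0) * Real.sin θ + I 1 * Real.cos θ
     let i'd := Idot 0 * Real.cos θ + Idot 1 * Real.sin θ + ω * iq
     let i'q := -(Idot 0) * Real.sin θ + Idot 1 * Real.cos θ - ω * id
     let i'f := Idot 2
     Matrix.det O₅ =
       (1 / (LD * Lq)) * ((Lδ * id + Mf * I 2) ^ 2 + LΔ * Lδ * iq ^ 2) * ω +
         (LΔ / (LD * Lq)) *
           ((Lδ * i'd + Mf * i'f) * iq - (Lδ * id + Mf * I 2) * i'q)) := by
  intro L L' L'' R Req Idot M1 v1 v2 O₅ id iq i'd i'q i'f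
  have hdet : IsUnit L.det := (isUnit_iff_isUnit_det L).mp hinv
  have hv1 : L *ᵥ v1 = -(L' *ᵥ I) := by
    simp only [v1, mulVec_neg, mulVec_mulVec, mul_nonsing_inv_cancel_left _ _ hdet]
  have hv2 : L *ᵥ v2 = -(L' *ᵥ Idot) - ω • (L'' *ᵥ I) := by
    simp only [v2, mulVec_sub, mulVec_neg, mulVec_smul, mulVec_mulVec, Matrix.mul_assoc,
      nonsing_inv_mul L hdet, Matrix.mul_one, mul_nonsing_inv_cancel_left _ _ hdet]
  have hO : det O₅ = v1 0 * v2 1 - v1 1 * v2 0 := det_identity_rows ..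
  have cross := Lmat_mulVec_cross L₀ L₂ Mf Lf θ hLf v1 v2 _ _ hv1 hv2
  rw [← hO, ← hLd, ← hLq, ← hLD] at cross
  have hcs := Real.sin_sq_add_cos_sq θ
  have hdu : (-(L' *ᵥ I)) 0 * Real.cos θ + (-(L' *ᵥ I)) 1 * Real.sin θ -
      Mf / Lf * (-(L' *ᵥ I)) 2 = -(LΔ * iq) := by
    simp only [L', iq, Lmat'_eq, mulVec, dotProduct, Fin.sum_univ_three, of_apply, cons_val,
      Pi.neg_apply, Real.cos_two_mul', Real.sin_two_mul, hLΔ, hLδ, hLd, hLq]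
    field_simp
    grind
  have hqu : -((-(L' *ᵥ I)) 0) * Real.sin θ + (-(L' *ᵥ I)) 1 * Real.cos θ =
      -(Lδ * id + Mf * I 2) := by
    simp only [L', id, Lmat'_eq, mulVec, dotProduct, Fin.sum_univ_three, of_apply, cons_val,
      Pi.neg_apply, Real.cos_two_mul', Real.sin_two_mul, hLδ, hLd, hLq]
    grind
  have hdw : (-(L' *ᵥ Idot) - ω • (L'' *ᵥ I)) 0 * Real.cos θ +
      (-(L' *ᵥ Idot) - ω • (L'' *ᵥ I)) 1 * Real.sin θ -
      Mf / Lf * (-(L' *ᵥ Idot) - ω • (L'' *ᵥ I)) 2 =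
      -(LΔ * i'q) + ω * (Lδ * id + Mf * I 2) := by
    simp only [i'q, id]
    generalize Idot = J
    simp only [L', L'', Lmat'_eq, Lmat''_eq, mulVec, dotProduct, Fin.sum_univ_three,
      of_apply, cons_val, Pi.neg_apply, Pi.sub_apply, Pi.smul_apply, smul_eq_mul,
      Real.cos_two_mul', Real.sin_two_mul, hLΔ, hLδ, hLd, hLq]
    field_simp
    grind
  have hqw : -((-(L' *ᵥ Idot) - ω • (L'' *ᵥ I)) 0) * Real.sin θ +
      (-(L' *ᵥ Idot) - ω • (L'' *ᵥ I)) 1 * Real.cos θ =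
      -(Lδ * i'd + Mf * i'f + ω * Lδ * iq) := by
    simp only [i'd, i'f, iq]
    generalize Idot = J
    simp only [L', L'', Lmat'_eq, Lmat''_eq, mulVec, dotProduct, Fin.sum_univ_three,
      of_apply, cons_val, Pi.neg_apply, Pi.sub_apply, Pi.smul_apply, smul_eq_mul,
      Real.cos_two_mul', Real.sin_two_mul, hLδ, hLd, hLq]
    grind
  rw [hdu, hqu, hdw, hqw] at cross
  have hdet_eq := eq_div_of_mul_eq (mul_ne_zero hLDne hLqne) ((mul_comm _ _).trans cross)
  rw [hdet_eq]
  ring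
end

section
/- Let L_d, L_q be nonzero reals with L_δ := L_d − L_q, let ψ_r ∈ ℝ, and let i_d, i_q : ℝ → ℝ be differentiable at t. Define Ψ_d(s) := L_δ·i_d(s) + ψ_r and Ψ_q(s) := L_δ·i_q(s) (the components of the observability vector), and suppose Ψ_d(t) ≠ 0. Then the IPMSM observability determinant Δ_IPMSM(t) := (1/(L_d L_q))·[Ψ_d(t)² + Ψ_q(t)²]·ω(t) + (L_δ/(L_d L_q))·[L_δ·i_d'(t)·i_q(t) − (L_δ·i_d(t) + ψ_r)·i_q'(t)] satisfies Δ_IPMSM(t) = (1/(L_d L_q))·(Ψ_d(t)² + Ψ_q(t)²)·(ω(t) − θ_O'(t)), where θ_O(s) := arctan(Ψ_q(s)/Ψ_d(s)). In particular, if Ψ_d(t)² + Ψ_q(t)² ≠ 0 then Δ_IPMSM(t) ≠ 0 if and only if ω(t) ≠ θ_O'(t). -/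
/-- The derivative of the phase `arctan (g / f)` of a planar curve `(f, g)` away from `f = 0`. -/
theorem HasDerivAt.arctan_div {f g : ℝ → ℝ} {f' g' t : ℝ}
    (hf : HasDerivAt f f' t) (hg : HasDerivAt g g' t) (h0 : f t ≠ 0) :
    HasDerivAt (fun s => Real.arctan (g s / f s))
      ((g' * f t - g t * f') / (f t ^ 2 + g t ^ 2)) t := by
  have hpos : f t ^ 2 + g t ^ 2 ≠ 0 := by positivity
  convert (hg.fun_div hf h0).arctan using 1
  field_simp

/-- Geometric interpretation of the IPMSM observability determinant via the
observability vector `(Ψ_d, Ψ_q) = (L_δ i_d + ψ_r, L_δ i_q)` and its phase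
`θ_O = arctan(Ψ_q/Ψ_d)`. -/
theorem ipmsm_determinant_observability_vector
    (Ld Lq : ℝ) (hLd : Ld ≠ 0) (hLq : Lq ≠ 0)
    (Lδ : ℝ) (hLδ : Lδ = Ld - Lq)
    (ψr : ℝ) (id iq ω : ℝ → ℝ) (t : ℝ)
    (hid : DifferentiableAt ℝ id t) (hiq : DifferentiableAt ℝ iq t)
    (hΨd : Lδ * id t + ψr ≠ 0) :
    (1 / (Ld * Lq)) * ((Lδ * id t + ψr) ^ 2 + (Lδ * iq t) ^ 2) * ω t +
        (Lδ / (Ld * Lq)) * (Lδ * deriv id t * iq t - (Lδ * id t + ψr) * deriv iq t) =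
      (1 / (Ld * Lq)) * ((Lδ * id t + ψr) ^ 2 + (Lδ * iq t) ^ 2) *
        (ω t - deriv (fun s => Real.arctan (Lδ * iq s / (Lδ * id s + ψr))) t) ∧
    ((Lδ * id t + ψr) ^ 2 + (Lδ * iq t) ^ 2 ≠ 0 →
      ((1 / (Ld * Lq)) * ((Lδ * id t + ψr) ^ 2 + (Lδ * iq t) ^ 2) * ω t +
          (Lδ / (Ld * Lq)) *
            (Lδ * deriv id t * iq t - (Lδ * id t + ψr) * deriv iq t) ≠ 0 ↔
        ω t ≠ deriv (fun s => Real.arctan (Lδ * iq s / (Lδ * id s + ψr))) t)) := by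
  have hθ := (((hid.hasDerivAt.const_mul Lδ).add_const ψr).arctan_div
    (hiq.hasDerivAt.const_mul Lδ) hΨd).deriv
  have hnorm : (Lδ * id t + ψr) ^ 2 + (Lδ * iq t) ^ 2 ≠ 0 := by positivity
  rw [hθ, and_iff_left_of_imp]
  · field_simp
    ring
  · intro hΔ _
    rw [hΔ, mul_ne_zero_iff, sub_ne_zero, and_iff_right]
    exact mul_ne_zero (one_div_ne_zero (mul_ne_zero hLd hLq)) hnorm
end

section
/- Let L_d, L_q be nonzero reals with L_δ := L_d − L_q ≠ 0, and let i_d, i_q, ω : ℝ → ℝ with i_d, i_q differentiable at t and i_d(t) ≠ 0. Then the SyRM observability determinant Δ_SyRM(t) := (L_δ²/(L_d L_q))·[(i_d(t)² + i_q(t)²)·ω(t) + i_d'(t)·i_q(t) − i_d(t)·i_q'(t)] satisfies Δ_SyRM(t) = (L_δ²/(L_d L_q))·(i_d(t)² + i_q(t)²)·(ω(t) − θ_O'(t)), where θ_O(s) := arctan(i_q(s)/i_d(s)). In particular Δ_SyRM(t) ≠ 0 if and only if ω(t) ≠ θ_O'(t). -/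
/-- Geometric interpretation of the SyRM observability determinant via the phase
`θ_O = arctan(i_q/i_d)` of the observability vector. -/
theorem syrm_determinant_observability_vector
    (Ld Lq : ℝ) (hLd : Ld ≠ 0) (hLq : Lq ≠ 0)
    (Lδ : ℝ) (hLδ : Lδ = Ld - Lq) (hLδne : Lδ ≠ 0)
    (id iq ω : ℝ → ℝ) (t : ℝ)
    (hid : DifferentiableAt ℝ id t) (hiq : DifferentiableAt ℝ iq t)
    (hidne : id t ≠ 0) :
    (Lδ ^ 2 / (Ld * Lq)) *
        ((id t ^ 2 + iq t ^ 2) * ω t + deriv id t * iq t - id t * deriv iq t) =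
      (Lδ ^ 2 / (Ld * Lq)) * (id t ^ 2 + iq t ^ 2) *
        (ω t - deriv (fun s => Real.arctan (iq s / id s)) t) ∧
    ((Lδ ^ 2 / (Ld * Lq)) *
        ((id t ^ 2 + iq t ^ 2) * ω t + deriv id t * iq t - id t * deriv iq t) ≠ 0 ↔
      ω t ≠ deriv (fun s => Real.arctan (iq s / id s)) t) := by
  have hpos : 0 < id t ^ 2 + iq t ^ 2 := by positivity
  have hθ : (id t ^ 2 + iq t ^ 2) * deriv (fun s => Real.arctan (iq s / id s)) t =
      deriv iq t * id t - iq t * deriv id t := by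
    rw [(hiq.hasDerivAt.fun_div hid.hasDerivAt hidne).arctan.deriv]
    have h : 1 + (iq t / id t) ^ 2 = (id t ^ 2 + iq t ^ 2) / id t ^ 2 := by
      field_simp
    rw [h]
    field_simp
  have hΔ : (Lδ ^ 2 / (Ld * Lq)) *
        ((id t ^ 2 + iq t ^ 2) * ω t + deriv id t * iq t - id t * deriv iq t) =
      (Lδ ^ 2 / (Ld * Lq)) * (id t ^ 2 + iq t ^ 2) *
        (ω t - deriv (fun s => Real.arctan (iq s / id s)) t) := by
    linear_combination (Lδ ^ 2 / (Ld * Lq)) * hθ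
  refine ⟨hΔ, ?_⟩
  have hcoeff : (Lδ ^ 2 / (Ld * Lq)) * (id t ^ 2 + iq t ^ 2) ≠ 0 :=
    mul_ne_zero (div_ne_zero (pow_ne_zero 2 hLδne) (mul_ne_zero hLd hLq)) hpos.ne'
  rw [hΔ, mul_ne_zero_iff_left hcoeff, sub_ne_zero]
end
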